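/- arXiv:2111.07754 — 2 statements merged into one kernel-verified Lean document; each statement's English description precedes it below -/
import Mathlib

section
/- For every positive integer l and every nonnegative integer n, R_{A_l}(n) = R_{B_l}(n). -/
/-- `R S n` is the number of pairs `(s₁, s₂)` with `s₁, s₂ ∈ S`, `s₁ < s₂` and `s₁ + s₂ = n`. -/
noncomputable def R (S : Set ℕ) (n : ℕ) : ℕ :=
  Set.ncard {p : ℕ × ℕ | p.1 ∈ S ∧ p.2 ∈ S ∧ p.1 < p.2 ∧ p.1 + p.2 = n}

/-- `A` is the set of nonnegative integers with an even number of binary digits `1`. -/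
def A : Set ℕ := {n | Even ((Nat.digits 2 n).count 1)}

/-- `B = ℕ \ A`. -/
def B : Set ℕ := Set.univ \ A

/-- `A_l = A ∩ [0, 2^l - 1]`. -/
def Aset (l : ℕ) : Set ℕ := A ∩ Set.Icc 0 (2 ^ l - 1)

/-- `B_l = B ∩ [0, 2^l - 1]`. -/
def Bset (l : ℕ) : Set ℕ := B ∩ Set.Icc 0 (2 ^ l - 1)

/-- `t + S = {t + s : s ∈ S}`. -/
def shift (t : ℕ) (S : Set ℕ) : Set ℕ := (fun s => t + s) '' S

theorem two_mul_mem_A (k : ℕ) : 2 * k ∈ A ↔ k ∈ A := by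
  rcases Nat.eq_zero_or_pos k with rfl | hk
  · rfl
  · simp [A, Nat.digits_base_mul one_lt_two hk]

theorem two_mul_add_one_mem_A (k : ℕ) : 2 * k + 1 ∈ A ↔ k ∉ A := by
  have hk : (2 * k + 1) / 2 = k := by omega
  simp [A, hk, Nat.even_add_one, Nat.add_mod]

theorem mem_A_div_two (a : ℕ) : a ∈ A ↔ (a % 2 = 0 ↔ a / 2 ∈ A) := by
  rcases Nat.mod_two_eq_zero_or_one a with h | h
  · obtain ⟨k, rfl⟩ : ∃ k, a = 2 * k := ⟨a / 2, by omega⟩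
    simp [two_mul_mem_A]
  · obtain ⟨k, rfl⟩ : ∃ k, a = 2 * k + 1 := ⟨a / 2, by omega⟩
    have hk : (2 * k + 1) / 2 = k := by omega
    simp [two_mul_add_one_mem_A, hk, Nat.add_mod]

/-- `flipDiff a b` is `a` with the lowest binary digit in which `a` and `b` differ flipped
(and `a` itself if `a = b`). -/
def flipDiff (a b : ℕ) : ℕ :=
  if a = b then a
  else if a % 2 = b % 2 then 2 * flipDiff (a / 2) (b / 2) + a % 2
  else 2 * (a / 2) + b % 2
termination_by a + b
decreasing_by omega

theorem flipDiff_of_mod_eq {a b : ℕ} (h : a ≠ b) (hm : a % 2 = b % 2) :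
    flipDiff a b = 2 * flipDiff (a / 2) (b / 2) + a % 2 := by
  rw [flipDiff, if_neg h, if_pos hm]

theorem flipDiff_of_mod_ne {a b : ℕ} (hm : a % 2 ≠ b % 2) :
    flipDiff a b = 2 * (a / 2) + b % 2 := by
  rw [flipDiff, if_neg (fun h => hm (by rw [h])), if_neg hm]

/-- Induction along the lowest binary digit in which two distinct numbers differ. -/
theorem diff_induction {P : ℕ → ℕ → Prop}
    (step : ∀ a b, a ≠ b → a % 2 = b % 2 → a / 2 ≠ b / 2 → P (a / 2) (b / 2) → P a b)
    (base : ∀ a b, a % 2 ≠ b % 2 → P a b) (a b : ℕ) (h : a ≠ b) : P a b := by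
  induction a using Nat.strong_induction_on generalizing b with
  | _ a ih =>
    by_cases hm : a % 2 = b % 2
    · have hd : a / 2 ≠ b / 2 := by omega
      rcases Nat.eq_zero_or_pos a with rfl | ha
      · clear ih
        induction b using Nat.strong_induction_on with
        | _ b ihb =>
          refine step _ _ h hm hd ?_
          by_cases hm' : 0 % 2 = b / 2 % 2
          · exact ihb (b / 2) (by omega) (by omega) hm' (by omega)
          · exact base _ _ hm'
      · exact step a b h hm hd (ih (a / 2) (by omega) _ hd)
    · exact base a b hm

theorem flipDiff_add_flipDiff (a b : ℕ) (h : a ≠ b) : flipDiff a b + flipDiff b a = a + b := by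
  refine diff_induction (P := fun a b => flipDiff a b + flipDiff b a = a + b) ?_ ?_ a b h
  · intro a b h hm _ ih
    rw [flipDiff_of_mod_eq h hm, flipDiff_of_mod_eq h.symm hm.symm]
    omega
  · intro a b hm
    rw [flipDiff_of_mod_ne hm, flipDiff_of_mod_ne hm.symm]
    omega

theorem flipDiff_flipDiff (a b : ℕ) (h : a ≠ b) :
    flipDiff a b ≠ flipDiff b a ∧ flipDiff (flipDiff a b) (flipDiff b a) = a := by
  refine diff_induction (P := fun a b => flipDiff a b ≠ flipDiff b a ∧
    flipDiff (flipDiff a b) (flipDiff b a) = a) ?_ ?_ a b h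
  · rintro a b h hm _ ⟨ih₁, ih₂⟩
    rw [flipDiff_of_mod_eq h hm, flipDiff_of_mod_eq h.symm hm.symm]
    generalize flipDiff (a / 2) (b / 2) = x at *
    generalize flipDiff (b / 2) (a / 2) = y at *
    refine ⟨by omega, ?_⟩
    have hx : (2 * x + a % 2) / 2 = x := by omega
    have hy : (2 * y + b % 2) / 2 = y := by omega
    rw [flipDiff_of_mod_eq (by omega) (by omega), hx, hy, ih₂]
    omega
  · intro a b hm
    rw [flipDiff_of_mod_ne hm, flipDiff_of_mod_ne hm.symm]
    refine ⟨by omega, ?_⟩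
    rw [flipDiff_of_mod_ne (by omega)]
    omega

theorem flipDiff_mem_A (a b : ℕ) (h : a ≠ b) : flipDiff a b ∈ A ↔ a ∉ A := by
  refine diff_induction (P := fun a b => flipDiff a b ∈ A ↔ a ∉ A) ?_ ?_ a b h
  · intro a b h hm _ ih
    rw [flipDiff_of_mod_eq h hm, mem_A_div_two, mem_A_div_two a]
    have hx : (2 * flipDiff (a / 2) (b / 2) + a % 2) / 2 = flipDiff (a / 2) (b / 2) := by omega
    have hx' : (2 * flipDiff (a / 2) (b / 2) + a % 2) % 2 = a % 2 := by omega
    rw [hx, hx', ih]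
    tauto
  · intro a b hm
    rw [flipDiff_of_mod_ne hm, mem_A_div_two, mem_A_div_two a]
    have hx : (2 * (a / 2) + b % 2) / 2 = a / 2 := by omega
    have hx' : (2 * (a / 2) + b % 2) % 2 = 0 ↔ ¬ a % 2 = 0 := by omega
    rw [hx, hx']
    tauto

theorem flipDiff_lt_two_pow (a b : ℕ) (h : a ≠ b) (l : ℕ) (ha : a < 2 ^ l) (hb : b < 2 ^ l) :
    flipDiff a b < 2 ^ l := by
  refine diff_induction (P := fun a b => ∀ l, a < 2 ^ l → b < 2 ^ l → flipDiff a b < 2 ^ l)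
    ?_ ?_ a b h l ha hb
  · intro a b h hm _ ih l ha hb
    rw [flipDiff_of_mod_eq h hm]
    cases l with
    | zero => omega
    | succ l =>
      have := ih l (by omega) (by omega)
      omega
  · intro a b hm l ha hb
    rw [flipDiff_of_mod_ne hm]
    cases l with
    | zero => omega
    | succ l => omega

theorem flipDiff_lt_flipDiff (a b : ℕ) (h : a < b) (hA : a ∈ A ↔ b ∈ A) :
    flipDiff a b < flipDiff b a := by
  refine diff_induction (P := fun a b => a < b → (a ∈ A ↔ b ∈ A) → flipDiff a b < flipDiff b a)
    ?_ ?_ a b h.ne h hA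
  · intro a b h hm _ ih hlt hA
    rw [flipDiff_of_mod_eq h hm, flipDiff_of_mod_eq h.symm hm.symm]
    rw [mem_A_div_two, mem_A_div_two b, hm] at hA
    have := ih (by omega) (by tauto)
    omega
  · intro a b hm hlt hA
    rw [flipDiff_of_mod_ne hm, flipDiff_of_mod_ne hm.symm]
    have hd : a / 2 ≠ b / 2 := by
      intro hd
      rw [mem_A_div_two, mem_A_div_two b, hd] at hA
      have : a % 2 = 0 ↔ ¬ b % 2 = 0 := by omega
      tauto
    omega

theorem mem_Aset {l a : ℕ} : a ∈ Aset l ↔ a ∈ A ∧ a < 2 ^ l := by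
  have := Nat.two_pow_pos l
  simp only [Aset, Set.mem_inter_iff, Set.mem_Icc, Nat.zero_le, true_and]
  exact and_congr_right fun _ => by omega

theorem mem_Bset {l a : ℕ} : a ∈ Bset l ↔ a ∉ A ∧ a < 2 ^ l := by
  have := Nat.two_pow_pos l
  simp only [Bset, B, Set.mem_inter_iff, Set.mem_sdiff, Set.mem_univ, Set.mem_Icc, Nat.zero_le,
    true_and]
  exact and_congr_right fun _ => by omega

theorem stmt_10 (l : ℕ) (hl : 0 < l) (n : ℕ) : R (Aset l) n = R (Bset l) n := by
  let f : ℕ × ℕ → ℕ × ℕ := fun p => (flipDiff p.1 p.2, flipDiff p.2 p.1)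
  have hf : ∀ p : ℕ × ℕ, p.1 < p.2 → f (f p) = p := fun p hp =>
    Prod.ext (flipDiff_flipDiff _ _ hp.ne).2 (flipDiff_flipDiff _ _ hp.ne').2
  have key : ∀ a b : ℕ, a < b → (a ∈ A ↔ b ∈ A) → a < 2 ^ l → b < 2 ^ l →
      (flipDiff a b ∈ A ↔ a ∉ A) ∧ (flipDiff b a ∈ A ↔ b ∉ A) ∧ flipDiff a b < 2 ^ l ∧
      flipDiff b a < 2 ^ l ∧ flipDiff a b < flipDiff b a ∧ flipDiff a b + flipDiff b a = a + b :=
    fun a b h hA ha hb => ⟨flipDiff_mem_A a b h.ne, flipDiff_mem_A b a h.ne',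
      flipDiff_lt_two_pow a b h.ne l ha hb, flipDiff_lt_two_pow b a h.ne' l hb ha,
      flipDiff_lt_flipDiff a b h hA, flipDiff_add_flipDiff a b h.ne⟩
  unfold R
  simp only [mem_Aset, mem_Bset]
  refine Set.BijOn.ncard_eq (f := f) (Set.InvOn.bijOn (f' := f)
    ⟨fun p hp => hf p hp.2.2.1, fun p hp => hf p hp.2.2.1⟩ ?_ ?_)
  · rintro ⟨a, b⟩ ⟨⟨h₁, h₂⟩, ⟨h₃, h₄⟩, h₅, h₆⟩
    have := key a b h₅ (by tauto) h₂ h₄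
    simp only [f, Set.mem_ofPred_eq] at *
    grind
  · rintro ⟨a, b⟩ ⟨⟨h₁, h₂⟩, ⟨h₃, h₄⟩, h₅, h₆⟩
    have := key a b h₅ (by tauto) h₂ h₄
    simp only [f, Set.mem_ofPred_eq] at *
    grind
end

section
/- Let C and D be two sets of nonnegative integers such that C ∪ D = [0, m] \ {r} with 6 ≤ r ≤ m/2, C ∩ D = ∅, 0 ∈ C, and R_C(n) = R_D(n) for every nonnegative integer n. Then m = 2r. -/
/-- The Thue–Morse sequence with values `± 1`. -/
def thueMorse : ℕ → ℤ
  | 0 => 1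
  | n + 1 => if (n + 1) % 2 = 0 then thueMorse ((n + 1) / 2) else -thueMorse ((n + 1) / 2)
decreasing_by all_goals omega

theorem thueMorse_zero : thueMorse 0 = 1 := by
  rw [thueMorse]

theorem thueMorse_two_mul (n : ℕ) : thueMorse (2 * n) = thueMorse n := by
  rcases n with _ | n
  · rfl
  · rw [show 2 * (n + 1) = (2 * n + 1) + 1 by ring, thueMorse, if_pos (by omega)]
    congr 1
    omega

theorem thueMorse_two_mul_add_one (n : ℕ) : thueMorse (2 * n + 1) = -thueMorse n := by
  rw [thueMorse, if_neg (by omega)]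
  congr 2
  omega

theorem thueMorse_eq_one_or (n : ℕ) : thueMorse n = 1 ∨ thueMorse n = -1 := by
  induction n using Nat.strong_induction_on with
  | _ n ih =>
    rcases n with _ | n
    · exact Or.inl thueMorse_zero
    · rw [thueMorse]
      have := ih ((n + 1) / 2) (by omega)
      split_ifs <;> omega

/-- The coefficient sequence of `F(X ^ 2)`, where `f` is that of `F`. -/
def dilate (f : ℤ → ℤ) (n : ℤ) : ℤ := if n % 2 = 0 then f (n / 2) else 0

theorem dilate_sub_dilate {f : ℤ → ℤ} {s : ℤ} (n : ℕ)
    (h : f ↑(n / 2) = s * thueMorse (n / 2)) :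
    dilate f n - dilate f (n - 1) = s * thueMorse n := by
  obtain ⟨k, rfl | rfl⟩ : ∃ k, n = 2 * k ∨ n = 2 * k + 1 := ⟨n / 2, by omega⟩
  · rw [show 2 * k / 2 = k by omega] at h
    rw [thueMorse_two_mul, dilate, dilate, if_pos (by omega), if_neg (by omega), sub_zero, ← h]
    congr 1
    omega
  · rw [show (2 * k + 1) / 2 = k by omega] at h
    rw [thueMorse_two_mul_add_one, dilate, dilate, if_neg (by omega), if_pos (by omega),
      mul_neg, ← h, zero_sub]
    congr 2
    omega

/-- The coefficientwise form of `F(X) (1 - X ^ (m + 1) - X ^ r + X ^ (r + 1)) = (1 - X) F(X ^ 2)`,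
for `F` supported on `[0, m]`. -/
structure IsSolution (m r : ℤ) (f : ℤ → ℤ) : Prop where
  neg : ∀ n < 0, f n = 0
  gt : ∀ n > m, f n = 0
  recurrence : ∀ n, f n = f (n - r) - f (n - r - 1) + f (n - m - 1) + dilate f n - dilate f (n - 1)

namespace IsSolution

variable {m r : ℤ} {f : ℤ → ℤ}

theorem reverse (h : IsSolution m r f) : IsSolution m (m - r) (fun n => f (m - n)) where
  neg n hn := h.gt _ (by omega)
  gt n hn := h.neg _ (by omega)
  recurrence n := by
    have key := h.recurrence (2 * m + 1 - n)
    have h1 : dilate f (2 * m + 1 - n) = dilate (fun n => f (m - n)) (n - 1) := by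
      unfold dilate
      by_cases hn : (n - 1) % 2 = 0
      · rw [if_pos (by omega), if_pos hn]
        congr 1
        omega
      · rw [if_neg (by omega), if_neg hn]
    have h2 : dilate f (2 * m + 1 - n - 1) = dilate (fun n => f (m - n)) n := by
      unfold dilate
      by_cases hn : n % 2 = 0
      · rw [if_pos (by omega), if_pos hn]
        congr 1
        omega
      · rw [if_neg (by omega), if_neg hn]
    rw [h1, h2] at key
    rw [show m - (n - (m - r)) = 2 * m + 1 - n - r - 1 by ring,
      show m - (n - (m - r) - 1) = 2 * m + 1 - n - r by ring,
      show m - (n - m - 1) = 2 * m + 1 - n by ring,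
      show m - n = 2 * m + 1 - n - m - 1 by ring]
    linarith

theorem eq_thueMorse (h : IsSolution m r f) (hrm : r ≤ m) (n : ℕ) (hn : n < r) :
    f n = f 0 * thueMorse n := by
  induction n using Nat.strong_induction_on with
  | _ n ih =>
    rcases Nat.eq_zero_or_pos n with rfl | hpos
    · simp [thueMorse_zero]
    · rw [h.recurrence, h.neg (n - r) (by omega), h.neg (n - r - 1) (by omega),
        h.neg (n - m - 1) (by omega),
        ← dilate_sub_dilate n (ih (n / 2) (by omega) (by omega))]
      ring

theorem thueMorse_of_eq_zero (h : IsSolution m r f) (hrm : r ≤ m) (k : ℕ) (hk : (k : ℤ) = r)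
    (hk0 : 0 < k) (h0 : f 0 ≠ 0) (hr : f r = 0) : thueMorse k = -1 := by
  have key := h.recurrence r
  have hd := dilate_sub_dilate k (h.eq_thueMorse hrm (k / 2) (by omega))
  rw [hk] at hd
  rw [hr, sub_self, h.neg (0 - 1) (by omega), h.neg (r - m - 1) (by omega)] at key
  have : f 0 * (1 + thueMorse k) = 0 := by linarith
  have := (mul_eq_zero.1 this).resolve_left h0
  linarith

end IsSolution

theorem IsSolution.eq_two_mul {m r : ℕ} {f : ℤ → ℤ} (h : IsSolution m r f) (hr4 : 4 ≤ r)
    (hrm : 2 * r ≤ m) (h0 : f 0 = 1) (hr : f r = 0)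
    (hpm : ∀ n : ℕ, n ≤ m → n ≠ r → f n = 1 ∨ f n = -1) : m = 2 * r := by
  have low (n : ℕ) (hn : n < r) : f n = thueMorse n := by
    rw [h.eq_thueMorse (by omega) n (by omega), h0, one_mul]
  have hm := hpm m le_rfl (by omega)
  have high (k n : ℕ) (hk : n + k = m) (hn : r < n) : f n = f m * thueMorse k := by
    have := h.reverse.eq_thueMorse (by omega) k (by omega)
    simp only [sub_zero] at this
    rw [← this]
    congr 1
    omega
  have tr : thueMorse r = -1 :=
    h.thueMorse_of_eq_zero (by omega) r rfl (by omega) (by omega) hr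
  have tmr (k : ℕ) (hk : r + k = m) : thueMorse k = -1 := by
    refine h.reverse.thueMorse_of_eq_zero (by omega) k (by omega) (by omega) ?_ ?_
    · simp only [sub_zero]
      omega
    · simpa using hr
  have t0 := thueMorse_zero
  have t1 : thueMorse 1 = -1 := by rw [thueMorse_two_mul_add_one 0, t0]
  have t2 : thueMorse 2 = -1 := by rw [thueMorse_two_mul 1, t1]
  have t3 : thueMorse 3 = 1 := by rw [thueMorse_two_mul_add_one 1, t1]; rfl
  -- the recurrence with natural number indices
  have recur (n k : ℕ) (hnm : n ≤ m) (hk : n = r + (k + 1)) :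
      f n = f ↑(k + 1) - f k + dilate f n - dilate f (n - 1) := by
    rw [h.recurrence n, h.neg (n - m - 1) (by omega), show (n : ℤ) - r = ↑(k + 1) by omega,
      show ((k + 1 : ℕ) : ℤ) - 1 = k by omega]
    ring
  have mid (k : ℕ) (hk : k + 1 < r) :
      f ↑(r + (k + 1)) = thueMorse (k + 1) - thueMorse k + thueMorse (r + (k + 1)) := by
    have hd := dilate_sub_dilate (s := 1) (r + (k + 1))
      (by rw [one_mul]; exact low _ (by omega))
    rw [recur _ k (by omega) rfl, low _ hk, low k (by omega)]
    linarith
  have fr1 := mid 0 (by omega)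
  have fr2 := mid 1 (by omega)
  have fr3 := mid 2 (by omega)
  norm_num only [t0, t1, t2, t3] at fr1 fr2 fr3
  have p1 := hpm (r + 1) (by omega) (by omega)
  have p3 := hpm (r + 3) (by omega) (by omega)
  have q1 := thueMorse_eq_one_or (r + 1)
  have q3 := thueMorse_eq_one_or (r + 3)
  have dodd (k : ℕ) : dilate f (2 * k + 1) = 0 := by
    rw [dilate, if_neg (by omega)]
  have deven (k : ℕ) : dilate f (2 * k) = f k := by
    rw [dilate, if_pos (by omega)]
    congr 1
    omega
  by_contra hne
  have f2r1 : f ↑(2 * r + 1) = -1 := by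
    have := recur (2 * r + 1) r (by omega) (by omega)
    rw [hr] at this
    push_cast at this p1 fr1 ⊢
    rw [dodd, add_sub_cancel_right, deven, hr] at this
    omega
  have hm1 : m ≠ 2 * r + 1 := by
    intro hm1
    have := tmr (r + 1) (by omega)
    push_cast at *
    omega
  have f2r2 : f ↑(2 * r + 2) = f ↑(r + 2) := by
    have := recur (2 * r + 2) (r + 1) (by omega) (by omega)
    have e1 := deven (r + 1)
    have e2 := dodd r
    rw [show ((2 * r + 2 : ℕ) : ℤ) - 1 = 2 * r + 1 by omega, e2,
      show ((2 * r + 2 : ℕ) : ℤ) = 2 * ((r + 1 : ℕ) : ℤ) by omega, e1] at this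
    rw [show ((2 * r + 2 : ℕ) : ℤ) = 2 * ((r + 1 : ℕ) : ℤ) by omega, this]
    ring
  have hm2 : m ≠ 2 * r + 2 := by
    intro hm2
    have a := tmr (r + 2) (by omega)
    have b := high 1 (2 * r + 1) (by omega) (by omega)
    rw [t1, hm2] at b
    omega
  have f2r3 : f ↑(2 * r + 3) = f ↑(r + 3) - f ↑(r + 2) - f ↑(r + 1) := by
    have := recur (2 * r + 3) (r + 2) (by omega) (by omega)
    have e1 := deven (r + 1)
    have e2 := dodd (r + 1)
    rw [show ((2 * r + 3 : ℕ) : ℤ) - 1 = 2 * ((r + 1 : ℕ) : ℤ) by omega, e1,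
      show ((2 * r + 3 : ℕ) : ℤ) = 2 * ((r + 1 : ℕ) : ℤ) + 1 by omega, e2] at this
    rw [show ((2 * r + 3 : ℕ) : ℤ) = 2 * ((r + 1 : ℕ) : ℤ) + 1 by omega, this]
    ring
  have q2 := thueMorse_eq_one_or (r + 2)
  have p23 := hpm (2 * r + 3) (by omega) (by omega)
  have s1 : thueMorse (r + 1) = 1 := by omega
  have s2 : thueMorse (r + 2) = 1 := by omega
  obtain ⟨a, ha | ha⟩ : ∃ a, r = 2 * a ∨ r = 2 * a + 1 := ⟨r / 2, by omega⟩
  swap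
  · rw [ha, show 2 * a + 1 + 2 = 2 * (a + 1) + 1 by ring, thueMorse_two_mul_add_one] at s2
    rw [ha, show 2 * a + 1 + 1 = 2 * (a + 1) by ring, thueMorse_two_mul] at s1
    omega
  have anti (k : ℕ) (hk : k < r) : thueMorse (r + k) = -thueMorse k := by
    have aux (b : ℕ) (hb : 2 * b + 1 < r) : thueMorse (a + b) = -thueMorse b := by
      have h1 := mid (2 * b) hb
      have h2 := hpm (r + (2 * b + 1)) (by omega) (by omega)
      have h3 := thueMorse_eq_one_or b
      have h4 := thueMorse_eq_one_or (a + b)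
      rw [show thueMorse (r + (2 * b + 1)) = -thueMorse (a + b) by
        rw [← thueMorse_two_mul_add_one, ha]; congr 1; ring,
        thueMorse_two_mul_add_one, thueMorse_two_mul] at h1
      omega
    obtain ⟨b, hb | hb⟩ : ∃ b, k = 2 * b ∨ k = 2 * b + 1 := ⟨k / 2, by omega⟩
    · rw [hb, ha, ← mul_add, thueMorse_two_mul, thueMorse_two_mul, aux b (by omega)]
    · rw [hb, ha, ← add_assoc, ← mul_add, thueMorse_two_mul_add_one, thueMorse_two_mul_add_one,
        aux b (by omega)]
  have block1 (k : ℕ) (hk : k < r) : f ↑(r + (k + 1)) = -thueMorse k := by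
    rcases Nat.lt_or_ge (k + 1) r with hk' | hk'
    · rw [mid k hk', anti _ hk']
      ring
    · have := recur (r + (k + 1)) k (by omega) rfl
      obtain rfl : r = k + 1 := by omega
      rw [show ((k + 1 + (k + 1) : ℕ) : ℤ) - 1 = 2 * k + 1 by omega, dodd,
        show ((k + 1 + (k + 1) : ℕ) : ℤ) = 2 * ((k + 1 : ℕ) : ℤ) by omega, deven, hr,
        low k (by omega)] at this
      rw [show ((k + 1 + (k + 1) : ℕ) : ℤ) = 2 * ((k + 1 : ℕ) : ℤ) by omega, this]
      ring
  have hm3 : m < 3 * r + 2 := by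
    by_contra! hm3
    have := recur (3 * r + 2) (2 * r + 1) (by omega) (by omega)
    have e1 := deven (r + (a + 1))
    have e2 := dodd (r + a)
    rw [show 2 * r + 1 + 1 = 2 * r + 2 by ring, f2r1, f2r2, fr2, s2,
      show ((3 * r + 2 : ℕ) : ℤ) - 1 = 2 * ((r + a : ℕ) : ℤ) + 1 by omega, e2,
      show ((3 * r + 2 : ℕ) : ℤ) = 2 * ((r + (a + 1) : ℕ) : ℤ) by omega, e1,
      block1 a (by omega), ← thueMorse_two_mul a, ← ha] at this
    have p := hpm (3 * r + 2) (by omega) (by omega)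
    rw [show ((3 * r + 2 : ℕ) : ℤ) = 2 * ((r + (a + 1) : ℕ) : ℤ) by omega] at p
    omega
  obtain ⟨j, hj⟩ : ∃ j, m = 2 * r + 1 + j := ⟨m - (2 * r + 1), by omega⟩
  have u1 := high (r + j) (r + 1) (by omega) (by omega)
  have u2 := high j (2 * r + 1) (by omega) (by omega)
  rcases Nat.lt_or_ge j r with hjr | hjr
  · rw [anti j hjr] at u1
    have := thueMorse_eq_one_or j
    rcases hm with hm | hm <;> rw [hm] at u1 u2 <;> omega
  · have := tmr (2 * r + 1) (by omega)
    rw [thueMorse_two_mul_add_one] at this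
    omega

open scoped Classical in
theorem sum_antidiagonal_indicator (S : Set ℕ) (n : ℕ) :
    ∑ p ∈ Finset.HasAntidiagonal.antidiagonal n, S.indicator (1 : ℕ → ℤ) p.1 * S.indicator (1 : ℕ → ℤ) p.2 =
      2 * R S n + if n % 2 = 0 then S.indicator (1 : ℕ → ℤ) (n / 2) else 0 := by
  set a : ℕ → ℤ := S.indicator 1 with ha
  have hlt : ∑ p ∈ Finset.HasAntidiagonal.antidiagonal n, (if p.1 < p.2 then a p.1 * a p.2 else 0) = R S n := by
    have : {p : ℕ × ℕ | p.1 ∈ S ∧ p.2 ∈ S ∧ p.1 < p.2 ∧ p.1 + p.2 = n} =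
        ↑((Finset.HasAntidiagonal.antidiagonal n).filter fun p => p.1 ∈ S ∧ p.2 ∈ S ∧ p.1 < p.2) := by
      ext p
      simp
      tauto
    rw [R, this, Set.ncard_coe_finset, Finset.card_filter]
    push_cast
    refine Finset.sum_congr rfl fun p _ => ?_
    by_cases h1 : p.1 ∈ S <;> by_cases h2 : p.2 ∈ S <;> simp [ha, h1, h2]
  have hgt : ∑ p ∈ Finset.HasAntidiagonal.antidiagonal n, (if p.2 < p.1 then a p.1 * a p.2 else 0) = R S n := by
    rw [← hlt, ← Finset.Nat.sum_antidiagonal_swap]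
    exact Finset.sum_congr rfl fun p _ => by simp [mul_comm]
  have heq : ∑ p ∈ Finset.HasAntidiagonal.antidiagonal n, (if p.1 = p.2 then a p.1 * a p.2 else 0) =
      if n % 2 = 0 then a (n / 2) else 0 := by
    have idem (k : ℕ) : a k * a k = a k := by
      by_cases h : k ∈ S <;> simp [ha, h]
    rw [Finset.sum_eq_single (n / 2, n - n / 2)]
    · by_cases hn : n % 2 = 0
      · rw [if_pos hn, if_pos (by dsimp only; omega), show n - n / 2 = n / 2 by omega, idem]
      · rw [if_neg hn, if_neg (by dsimp only; omega)]
    · rintro ⟨i, j⟩ hp hne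
      rw [Finset.HasAntidiagonal.mem_antidiagonal] at hp
      refine if_neg fun hij => hne ?_
      ext <;> dsimp only at * <;> omega
    · intro hp
      exact absurd (Finset.HasAntidiagonal.mem_antidiagonal.2 (by dsimp only; omega)) hp
  have hsplit : ∑ p ∈ Finset.HasAntidiagonal.antidiagonal n, a p.1 * a p.2 =
      ∑ p ∈ Finset.HasAntidiagonal.antidiagonal n, (if p.1 < p.2 then a p.1 * a p.2 else 0) +
      ∑ p ∈ Finset.HasAntidiagonal.antidiagonal n, (if p.2 < p.1 then a p.1 * a p.2 else 0) +
      ∑ p ∈ Finset.HasAntidiagonal.antidiagonal n, (if p.1 = p.2 then a p.1 * a p.2 else 0) := by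
    rw [← Finset.sum_add_distrib, ← Finset.sum_add_distrib]
    refine Finset.sum_congr rfl fun p _ => ?_
    rcases lt_trichotomy p.1 p.2 with h | h | h
    · simp [h, h.not_gt, h.ne]
    · simp [h]
    · simp [h, h.not_gt, h.ne']
  rw [hsplit, hlt, hgt, heq]
  ring

open PowerSeries in
/-- If the coefficient sequences `c`, `d` of two power series have sum the indicator of
`[0, m] \ {r}` and their squares differ by `(c - d)(X ^ 2)`, then `c - d` satisfies a linear
recurrence. -/
theorem recurrence_of_sum_antidiagonal {m r : ℕ} {c d : ℕ → ℤ} (hrm : r ≤ m)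
    (hsum : ∀ n, c n + d n = if n ≤ m ∧ n ≠ r then 1 else 0)
    (hsq : ∀ n, ∑ p ∈ Finset.HasAntidiagonal.antidiagonal n, c p.1 * c p.2 -
      ∑ p ∈ Finset.HasAntidiagonal.antidiagonal n, d p.1 * d p.2 =
        if n % 2 = 0 then c (n / 2) - d (n / 2) else 0) (n : ℕ) :
    c n - d n - (if m + 1 ≤ n then c (n - (m + 1)) - d (n - (m + 1)) else 0)
      - (if r ≤ n then c (n - r) - d (n - r) else 0)
      + (if r + 1 ≤ n then c (n - (r + 1)) - d (n - (r + 1)) else 0) =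
    (if n % 2 = 0 then c (n / 2) - d (n / 2) else 0) -
      (if 1 ≤ n then if (n - 1) % 2 = 0 then c ((n - 1) / 2) - d ((n - 1) / 2) else 0 else 0) := by
  set E : PowerSeries ℤ := mk fun n => if n % 2 = 0 then c (n / 2) - d (n / 2) else 0 with hE
  have h1 : (mk c - mk d) * (mk c + mk d) = E := by
    rw [show (mk c - mk d) * (mk c + mk d) = mk c * mk c - mk d * mk d by ring]
    ext n
    simp only [map_sub, coeff_mul, coeff_mk, hE]
    exact hsq n
  have h2 : (mk c + mk d) * (1 - X ^ 1) = 1 - X ^ (m + 1) - X ^ r + X ^ (r + 1) := by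
    ext n
    simp only [mul_sub, mul_one, map_sub, map_add, coeff_mul_X_pow', coeff_mk, coeff_X_pow,
      coeff_one, hsum]
    split_ifs <;> omega
  have h3 : (mk c - mk d) * (1 - X ^ (m + 1) - X ^ r + X ^ (r + 1)) = E * (1 - X ^ 1) := by
    rw [← h1, ← h2]
    ring
  have h4 := congrArg (coeff n) h3
  simpa only [hE, mul_sub, mul_add, mul_one, map_sub, map_add, coeff_mul_X_pow', coeff_mk] using h4

theorem stmt_19 (m r : ℕ) (hr6 : 6 ≤ r) (hrm : 2 * r ≤ m) (C D : Set ℕ)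
    (hCD : C ∪ D = Set.Icc 0 m \ {r}) (hdisj : C ∩ D = ∅) (h0C : 0 ∈ C)
    (hR : ∀ n : ℕ, R C n = R D n) :
    m = 2 * r := by
  classical
  have mem (n : ℕ) : (n ∈ C ∨ n ∈ D) ↔ n ≤ m ∧ n ≠ r := by
    simpa using Set.ext_iff.1 hCD n
  have nmem (n : ℕ) : ¬(n ∈ C ∧ n ∈ D) := by
    simpa using Set.ext_iff.1 hdisj n
  set c : ℕ → ℤ := C.indicator 1 with hc
  set d : ℕ → ℤ := D.indicator 1 with hd
  have hsum (n : ℕ) : c n + d n = if n ≤ m ∧ n ≠ r then 1 else 0 := by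
    have := nmem n
    rw [← if_congr (mem n) rfl rfl]
    by_cases h1 : n ∈ C <;> by_cases h2 : n ∈ D <;> simp_all
  have hdiff (n : ℕ) (h1 : n ≤ m) (h2 : n ≠ r) : c n - d n = 1 ∨ c n - d n = -1 := by
    have h3 := nmem n
    have h4 := (mem n).2 ⟨h1, h2⟩
    by_cases h1 : n ∈ C <;> by_cases h2 : n ∈ D <;> simp_all
  have hzero (n : ℕ) (h : ¬(n ≤ m ∧ n ≠ r)) : c n - d n = 0 := by
    rw [← mem, not_or] at h
    simp [hc, hd, h.1, h.2]
  have hrec := recurrence_of_sum_antidiagonal (m := m) (r := r) (c := c) (d := d) (by omega) hsum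
    (fun n => by
      rw [hc, hd, sum_antidiagonal_indicator, sum_antidiagonal_indicator, hR]
      split_ifs <;> ring)
  set f : ℤ → ℤ := fun z => if 0 ≤ z then c z.toNat - d z.toNat else 0 with hf
  have fcast (n : ℕ) : f n = c n - d n := by simp [hf]
  have fneg (z : ℤ) (hz : z < 0) : f z = 0 := if_neg (by omega)
  have fsub (n k : ℕ) : (if k ≤ n then c (n - k) - d (n - k) else 0) = f (n - k) := by
    split_ifs with h
    · rw [← fcast]
      congr 1
      omega
    · rw [fneg _ (by omega)]
  have dcast (n : ℕ) : (if n % 2 = 0 then c (n / 2) - d (n / 2) else 0) = dilate f n := by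
    rw [dilate, ← fcast]
    by_cases h : n % 2 = 0
    · rw [if_pos h, if_pos (by omega)]
      rfl
    · rw [if_neg h, if_neg (by omega)]
  have dneg (z : ℤ) (hz : z < 0) : dilate f z = 0 := by
    rw [dilate, fneg _ (by omega), ite_self]
  have sol : IsSolution m r f := by
    refine ⟨fneg, fun z hz => ?_, fun z => ?_⟩
    · lift z to ℕ using by omega
      rw [fcast, hzero z (by omega)]
    · rcases lt_or_ge z 0 with hz | hz
      · rw [fneg z hz, fneg _ (by omega), fneg _ (by omega), fneg _ (by omega), dneg z hz,
          dneg _ (by omega)]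
        ring
      · lift z to ℕ using hz
        have key := hrec z
        have h1 : (if 1 ≤ z then if (z - 1) % 2 = 0 then
            c ((z - 1) / 2) - d ((z - 1) / 2) else 0 else 0) = dilate f (z - 1) := by
          split_ifs with h1 h2
          · rw [show (z : ℤ) - 1 = (z - 1 : ℕ) by omega, ← dcast, if_pos h2]
          · rw [show (z : ℤ) - 1 = (z - 1 : ℕ) by omega, ← dcast, if_neg h2]
          · rw [dneg _ (by omega)]
        rw [h1, fsub, fsub, fsub, dcast, ← fcast] at key
        push_cast at key
        rw [← sub_sub, ← sub_sub] at key
        linarith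
  refine sol.eq_two_mul (by omega) hrm ?_ ?_ ?_
  · have : 0 ∉ D := fun h => nmem 0 ⟨h0C, h⟩
    simpa [hc, hd, h0C, this] using fcast 0
  · rw [fcast, hzero r (by simp)]
  · intro n h1 h2
    rw [fcast]
    exact hdiff n h1 h2
end
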